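/- Set f(t) = √(1 − 4t²). The contracting eigendirection v₂ = (2t, 1 + f(t)) of B lies in the closed cone spanned by the vectors (t, 1−s) (the direction of the segment from E₁=(0,0) to P₄) and (0,1); the expanding eigendirection v₁ = (1 + f(t), 2t) lies in the closed cone spanned by (1,0) and (s, t) (the direction of the segment from E₁ to P₁). That is, there exist nonnegative reals a, b, not both zero, with v₂ = a·(t, 1−s) + b·(0,1), and nonnegative reals c, d, not both zero, with v₁ = c·(1,0) + d·(s,t). -/

import Mathlib

open Real Set Filter

noncomputable section

/-- A point in the plane. -/
abbrev Pt : Type := ℝ × ℝ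

/-- The linear map `B` with matrix `(1/(t-s)) ⬝ [[t² - (1-s)², (1-2s)t], [(2s-1)t, (2t-1)t]]`. -/
def Bmap (s t : ℝ) : Pt → Pt := fun p =>
  ((1/(t-s)) * ((t^2 - (1-s)^2) * p.1 + (1-2*s)*t * p.2),
   (1/(t-s)) * ((2*s-1)*t * p.1 + (2*t-1)*t * p.2))

/-- The quadratic form `Q_B(x,y) = t(x² + y²) - xy`. -/
def QB (t : ℝ) (p : Pt) : ℝ := t * (p.1^2 + p.2^2) - p.1 * p.2

/-- With `f(t) = √(1-4t²)`, the contracting eigendirection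
`v₂ = (2t, 1+f(t))` of `B` lies in the closed cone spanned by `(t, 1-s)` and `(0,1)`,
and the expanding eigendirection `v₁ = (1+f(t), 2t)` lies in the closed cone spanned
by `(1,0)` and `(s,t)`. -/
theorem Bmap_eigendirections_in_cones (t : ℝ) (ht : t ∈ Ioo (0:ℝ) (1/2))
    (s : ℝ) (hs : s = Real.sqrt (t - t^2))
    (f : ℝ) (hf : f = Real.sqrt (1 - 4*t^2)) :
    (∃ a b : ℝ, 0 ≤ a ∧ 0 ≤ b ∧ ¬(a = 0 ∧ b = 0) ∧
      ((2*t, 1 + f) : Pt) = a • ((t, 1 - s) : Pt) + b • ((0, 1) : Pt)) ∧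
    (∃ c d : ℝ, 0 ≤ c ∧ 0 ≤ d ∧ ¬(c = 0 ∧ d = 0) ∧
      ((1 + f, 2*t) : Pt) = c • ((1, 0) : Pt) + d • ((s, t) : Pt)) := by
  obtain ⟨ht0, ht1⟩ := ht
  have hs0 : 0 ≤ s := hs ▸ Real.sqrt_nonneg _
  have hf0 : 0 ≤ f := hf ▸ Real.sqrt_nonneg _
  have hs2 : s ^ 2 = t - t ^ 2 := by
    rw [hs, Real.sq_sqrt (by nlinarith)]
  have hf2 : f ^ 2 = 1 - 4 * t ^ 2 := by
    rw [hf, Real.sq_sqrt (by nlinarith)]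
  have hs_le : 2 * s ≤ 1 := by nlinarith [sq_nonneg (1 - 2 * t)]
  have hsum : 1 ≤ f + 2 * s := by nlinarith [mul_nonneg hf0 hs0]
  refine ⟨⟨2, f + 2 * s - 1, by norm_num, by linarith, by norm_num, ?_⟩,
    ⟨1 + f - 2 * s, 2, by linarith, by norm_num, by norm_num, ?_⟩⟩
  all_goals
    ext <;> simp
    try ring
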